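/- arXiv:2504.08079 — 4 statements merged into one kernel-verified Lean document; each statement's English description precedes it below -/
import Mathlib

section
/- Suppose X*_h̄ is an α-weak sharp minima of order m ≥ 1. Then for every x ∈ E: ‖x − x*‖² ≤ (2/μ_f)·( f̄(x) − f̄* + ‖∇̃f̄(x*)‖·( (h̄(x) − h̄*)/α )^{1/m} ). -/
open scoped RealInnerProductSpace
open Metric Filter

noncomputable section

section

variable {E : Type*} [NormedAddCommGroup E] [InnerProductSpace ℝ E]

/-- A subgradient of a strongly convex function supports it from below with a quadratic term. -/
lemma StrongConvexOn.add_inner_add_sq_le_of_subgradient {φ : E → ℝ} {μ : ℝ} {g a : E}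
    (hφ : StrongConvexOn Set.univ μ φ) (hg : ∀ y, φ a + ⟪g, y - a⟫ ≤ φ y) (x : E) :
    φ a + ⟪g, x - a⟫ + μ / 2 * ‖x - a‖ ^ 2 ≤ φ x := by
  have hsegment : ∀ t ∈ Set.Ioo (0 : ℝ) 1,
      φ a + ⟪g, x - a⟫ + (1 - t) * (μ / 2 * ‖x - a‖ ^ 2) ≤ φ x := by
    rintro t ⟨ht₀, ht₁⟩
    have hconv := hφ.2 (Set.mem_univ x) (Set.mem_univ a) ht₀.le (sub_nonneg.2 ht₁.le) (by ring)
    have hsub := hg (t • x + (1 - t) • a)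
    have hdir : t • x + (1 - t) • a - a = t • (x - a) := by module
    rw [hdir, real_inner_smul_right] at hsub
    simp only [smul_eq_mul] at hconv
    refine le_of_mul_le_mul_left ?_ ht₀
    linarith
  have hlim : Tendsto (fun t : ℝ ↦ φ a + ⟪g, x - a⟫ + (1 - t) * (μ / 2 * ‖x - a‖ ^ 2))
      (nhdsWithin 0 (Set.Ioi 0)) (nhds (φ a + ⟪g, x - a⟫ + (1 - 0) * (μ / 2 * ‖x - a‖ ^ 2))) :=
    (Continuous.tendsto (by fun_prop) 0).mono_left nhdsWithin_le_nhds
  have hle := le_of_tendsto hlim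
    (eventually_of_mem (Ioo_mem_nhdsGT one_pos) hsegment)
  simpa using hle

/-- A linear functional that is nonnegative on `S - a` is bounded below in terms of the distance
to `S`. -/
lemma neg_norm_mul_infDist_le_inner {S : Set E} (hS : S.Nonempty) {g a : E}
    (hg : ∀ y ∈ S, (0 : ℝ) ≤ ⟪g, y - a⟫) (x : E) :
    -(‖g‖ * infDist x S) ≤ ⟪g, x - a⟫ := by
  have hpoint : ∀ y ∈ S, -⟪g, x - a⟫ ≤ ‖g‖ * dist x y := by
    intro y hy
    have hsplit : ⟪g, x - a⟫ = ⟪g, y - a⟫ - ⟪g, y - x⟫ := by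
      rw [← inner_sub_right]
      congr 1
      abel
    have hcs := real_inner_le_norm g (y - x)
    rw [dist_comm, dist_eq_norm]
    linarith [hg y hy]
  rcases (norm_nonneg g).eq_or_lt with hg₀ | hg₀
  · obtain ⟨y, hy⟩ := hS
    have hy' := hpoint y hy
    simp only [← hg₀, zero_mul] at hy' ⊢
    linarith
  · have hdist : -⟪g, x - a⟫ / ‖g‖ ≤ infDist x S :=
      (le_infDist hS).2 fun y hy ↦ (div_le_iff₀' hg₀).2 (hpoint y hy)
    linarith [(div_le_iff₀' hg₀).1 hdist]

end

theorem stmt_5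
    {n : ℕ}
    (f h ωf ωh : EuclideanSpace ℝ (Fin n) → ℝ)
    (f' h' : EuclideanSpace ℝ (Fin n) → EuclideanSpace ℝ (Fin n))
    (Lf Lh μf : ℝ)
    (hμf_pos : 0 < μf) (hμf_le : μf ≤ Lf) (hLh_pos : 0 < Lh)
    (hf_grad : ∀ x, HasGradientAt f (f' x) x)
    (hf_lip : ∀ x y, ‖f' x - f' y‖ ≤ Lf * ‖x - y‖)
    (hf_sc : StrongConvexOn Set.univ μf f)
    (hh_grad : ∀ x, HasGradientAt h (h' x) x)
    (hh_lip : ∀ x y, ‖h' x - h' y‖ ≤ Lh * ‖x - y‖)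
    (hh_conv : ConvexOn ℝ Set.univ h)
    (hωf_conv : ConvexOn ℝ Set.univ ωf)
    (hωh_conv : ConvexOn ℝ Set.univ ωh)
    (fbar hbar : EuclideanSpace ℝ (Fin n) → ℝ)
    (hfbar : ∀ x, fbar x = f x + ωf x)
    (hhbar : ∀ x, hbar x = h x + ωh x)
    (X : Set (EuclideanSpace ℝ (Fin n)))
    (hX : X = {z | ∀ y, hbar z ≤ hbar y})
    (hXne : X.Nonempty)
    (hstar : ℝ)
    (hhstar : IsGLB (Set.range hbar) hstar)
    (xstar : EuclideanSpace ℝ (Fin n))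
    (hxstar_mem : xstar ∈ X)
    (hxstar_min : ∀ y ∈ X, fbar xstar ≤ fbar y)
    (g : EuclideanSpace ℝ (Fin n))
    (hg_sub : ∀ y, fbar xstar + ⟪g, y - xstar⟫ ≤ fbar y)
    (hg_opt : ∀ y ∈ X, (0:ℝ) ≤ ⟪g, y - xstar⟫)
    (α m : ℝ) (hα : 0 < α) (hm : 1 ≤ m)
    (hws : ∀ z, α * Metric.infDist z X ^ m ≤ hbar z - hstar) :
    ∀ x, ‖x - xstar‖ ^ 2
        ≤ 2 / μf * (fbar x - fbar xstar
            + ‖g‖ * ((hbar x - hstar) / α) ^ (1 / m)) := by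
  intro x
  have hsc : StrongConvexOn Set.univ μf fbar := by
    rw [show fbar = f + ωf from funext hfbar]
    simpa [StrongConvexOn] using hf_sc.add (uniformConvexOn_zero.2 hωf_conv)
  have hquad := hsc.add_inner_add_sq_le_of_subgradient hg_sub x
  have hinner := neg_norm_mul_infDist_le_inner hXne hg_opt x
  have hdist : infDist x X ≤ ((hbar x - hstar) / α) ^ (1 / m) := by
    have hm₀ : 0 < m := one_pos.trans_le hm
    have hpow : infDist x X ^ m ≤ (hbar x - hstar) / α := (le_div_iff₀' hα).2 (hws x)
    rw [one_div]
    exact (Real.le_rpow_inv_iff_of_pos infDist_nonneg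
      ((Real.rpow_nonneg infDist_nonneg m).trans hpow) hm₀).2 hpow
  have hbound := mul_le_mul_of_nonneg_left hdist (norm_nonneg g)
  rw [div_mul_eq_mul_div, le_div_iff₀ hμf_pos]
  linarith
end
end

section
/- Let (x_k) be the IR-ISTA iterates. Then for every integer k ≥ 0: η_k·(f̄(x_{k+1}) − f̄*) + (h̄(x_{k+1}) − h̄*) ≤ (1/(2γ))·( (1 − η_k γ μ_f)·‖x_k − x*‖² − ‖x_{k+1} − x*‖² ). -/
open scoped RealInnerProductSpace
open Metric Filter

noncomputable section

section FirstOrderInequalities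

variable {E : Type*} [NormedAddCommGroup E] [InnerProductSpace ℝ E]

theorem le_of_forall_le_add_mul {a b e : ℝ} (hab : ∀ t : ℝ, 0 < t → t < 1 → a ≤ b + t * e) :
    a ≤ b := by
  have hlim : Tendsto (fun t : ℝ => b + t * e) (nhdsWithin 0 (Set.Ioi 0)) (nhds b) := by
    have hcont : Continuous fun t : ℝ => b + t * e := by fun_prop
    simpa using (hcont.tendsto 0).mono_left nhdsWithin_le_nhds
  refine ge_of_tendsto hlim ?_
  filter_upwards [Ioo_mem_nhdsGT (zero_lt_one' ℝ)] with t ht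
  exact hab t ht.1 ht.2

theorem HasDerivAt.le_of_forall_sub_le {φ : ℝ → ℝ} {d b e : ℝ} (hφ : HasDerivAt φ d 0)
    (hle : ∀ t : ℝ, 0 < t → t < 1 → φ t - φ 0 ≤ t * (b + t * e)) : d ≤ b := by
  have hslope := (hasDerivAt_iff_tendsto_slope_zero.1 hφ).mono_left
    (nhdsWithin_mono 0 (fun t ht => ne_of_gt ht : Set.Ioi (0 : ℝ) ⊆ {0}ᶜ))
  have hlim : Tendsto (fun t : ℝ => b + t * e) (nhdsWithin 0 (Set.Ioi 0)) (nhds b) := by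
    have hcont : Continuous fun t : ℝ => b + t * e := by fun_prop
    simpa using (hcont.tendsto 0).mono_left nhdsWithin_le_nhds
  refine le_of_tendsto_of_tendsto hslope hlim ?_
  filter_upwards [Ioo_mem_nhdsGT (zero_lt_one' ℝ)] with t ht
  have h := hle t ht.1 ht.2
  rw [zero_add, smul_eq_mul, inv_mul_le_iff₀ ht.1]
  exact h

theorem HasGradientAt.hasDerivAt_line [CompleteSpace E] {f : E → ℝ} {g x v : E} {t : ℝ}
    (hf : HasGradientAt f g (x + t • v)) :
    HasDerivAt (fun s : ℝ => f (x + s • v)) ⟪g, v⟫ t := by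
  have hline : HasDerivAt (fun s : ℝ => x + s • v) v t := by
    simpa using ((hasDerivAt_id t).smul_const v).const_add x
  exact (hf.hasFDerivAt.comp_hasDerivAt t hline).congr_deriv (by simp)

theorem StrongConvexOn.add_inner_gradient_le [CompleteSpace E] {f : E → ℝ} {m : ℝ} {g x : E}
    (hsc : StrongConvexOn Set.univ m f) (hf : HasGradientAt f g x) (y : E) :
    f x + ⟪g, y - x⟫ + m / 2 * ‖y - x‖ ^ 2 ≤ f y := by
  have hderiv : HasDerivAt (fun s : ℝ => f (x + s • (y - x))) ⟪g, y - x⟫ 0 :=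
    HasGradientAt.hasDerivAt_line (by simpa using hf)
  have hle := hderiv.le_of_forall_sub_le (b := f y - f x - m / 2 * ‖y - x‖ ^ 2)
    (e := m / 2 * ‖y - x‖ ^ 2) fun t ht0 ht1 => by
      have hconv := hsc.2 (Set.mem_univ x) (Set.mem_univ y) (sub_nonneg.2 ht1.le) ht0.le
        (sub_add_cancel 1 t)
      have hpoint : (1 - t) • x + t • y = x + t • (y - x) := by module
      rw [hpoint, norm_sub_rev x y] at hconv
      simp only [smul_eq_mul, zero_smul, add_zero] at hconv ⊢
      linarith
  linarith

theorem ConvexOn.add_inner_gradient_le [CompleteSpace E] {f : E → ℝ} {g x : E}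
    (hconv : ConvexOn ℝ Set.univ f) (hf : HasGradientAt f g x) (y : E) :
    f x + ⟪g, y - x⟫ ≤ f y := by
  simpa using (strongConvexOn_zero.2 hconv).add_inner_gradient_le hf y

theorem le_add_inner_gradient_of_lipschitz [CompleteSpace E] {f : E → ℝ} {f' : E → E} {L : ℝ}
    (hf : ∀ x, HasGradientAt f (f' x) x) (hlip : ∀ x y, ‖f' x - f' y‖ ≤ L * ‖x - y‖) (x y : E) :
    f y ≤ f x + ⟪f' x, y - x⟫ + L / 2 * ‖y - x‖ ^ 2 := by
  set v := y - x with hv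
  have hderiv (t : ℝ) : HasDerivAt
      (fun s : ℝ => f (x + s • v) - (s * ⟪f' x, v⟫ + s ^ 2 * (L / 2 * ‖v‖ ^ 2)))
      (⟪f' (x + t • v), v⟫ - (⟪f' x, v⟫ + 2 * t * (L / 2 * ‖v‖ ^ 2))) t := by
    refine (hf (x + t • v)).hasDerivAt_line.sub (HasDerivAt.add ?_ ?_)
    · simpa using (hasDerivAt_id t).mul_const ⟪f' x, v⟫
    · simpa using ((hasDerivAt_id t).pow 2).mul_const (L / 2 * ‖v‖ ^ 2)
  have hanti := antitoneOn_of_deriv_nonpos (convex_Icc (0 : ℝ) 1)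
    (fun t _ => (hderiv t).continuousAt.continuousWithinAt)
    (fun t _ => (hderiv t).differentiableAt.differentiableWithinAt)
    (fun t ht => by
      rw [interior_Icc] at ht
      rw [(hderiv t).deriv]
      have hinner := real_inner_le_norm (f' (x + t • v) - f' x) v
      have hbound := mul_le_mul_of_nonneg_right (hlip (x + t • v) x) (norm_nonneg v)
      rw [add_sub_cancel_left, norm_smul, Real.norm_of_nonneg ht.1.le] at hbound
      rw [inner_sub_left] at hinner
      linarith)
  have h01 := hanti (Set.left_mem_Icc.2 zero_le_one) (Set.right_mem_Icc.2 zero_le_one) zero_le_one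
  simp only [one_smul, zero_smul, add_zero, one_mul, zero_mul, one_pow, hv, add_sub_cancel] at h01
  norm_num at h01
  linarith

theorem ConvexOn.prox_three_point {ω : E → ℝ} (hω : ConvexOn ℝ Set.univ ω) {c : ℝ} {w p : E}
    (hp : ∀ u, ω p + c * ‖p - w‖ ^ 2 ≤ ω u + c * ‖u - w‖ ^ 2) (u : E) :
    ω p + c * ‖p - w‖ ^ 2 + c * ‖u - p‖ ^ 2 ≤ ω u + c * ‖u - w‖ ^ 2 := by
  have hexpand (t : ℝ) : ‖p + t • (u - p) - w‖ ^ 2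
      = ‖p - w‖ ^ 2 + 2 * t * ⟪p - w, u - p⟫ + t ^ 2 * ‖u - p‖ ^ 2 := by
    rw [show p + t • (u - p) - w = (p - w) + t • (u - p) by abel, norm_add_sq_real,
      real_inner_smul_right, norm_smul, mul_pow, Real.norm_eq_abs, sq_abs]
    ring
  have hle : ω p - ω u ≤ 2 * c * ⟪p - w, u - p⟫ :=
    le_of_forall_le_add_mul (e := c * ‖u - p‖ ^ 2) fun t ht0 ht1 => by
      have hconv := hω.2 (Set.mem_univ p) (Set.mem_univ u) (sub_nonneg.2 ht1.le) ht0.le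
        (sub_add_cancel 1 t)
      have hpoint : (1 - t) • p + t • u = p + t • (u - p) := by module
      rw [hpoint] at hconv
      have hmin := hp (p + t • (u - p))
      rw [hexpand] at hmin
      simp only [smul_eq_mul] at hconv
      refine le_of_mul_le_mul_left ?_ ht0
      linarith
  have h1 := hexpand 1
  rw [one_smul, add_sub_cancel] at h1
  rw [h1]
  linarith

end FirstOrderInequalities

theorem stmt_6
    {n : ℕ}
    (f h ωf ωh : EuclideanSpace ℝ (Fin n) → ℝ)
    (f' h' : EuclideanSpace ℝ (Fin n) → EuclideanSpace ℝ (Fin n))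
    (Lf Lh μf : ℝ)
    (hμf_pos : 0 < μf) (hμf_le : μf ≤ Lf) (hLh_pos : 0 < Lh)
    (hf_grad : ∀ x, HasGradientAt f (f' x) x)
    (hf_lip : ∀ x y, ‖f' x - f' y‖ ≤ Lf * ‖x - y‖)
    (hf_sc : StrongConvexOn Set.univ μf f)
    (hh_grad : ∀ x, HasGradientAt h (h' x) x)
    (hh_lip : ∀ x y, ‖h' x - h' y‖ ≤ Lh * ‖x - y‖)
    (hh_conv : ConvexOn ℝ Set.univ h)
    (hωf_conv : ConvexOn ℝ Set.univ ωf)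
    (hωh_conv : ConvexOn ℝ Set.univ ωh)
    (fbar hbar : EuclideanSpace ℝ (Fin n) → ℝ)
    (hfbar : ∀ x, fbar x = f x + ωf x)
    (hhbar : ∀ x, hbar x = h x + ωh x)
    (X : Set (EuclideanSpace ℝ (Fin n)))
    (hX : X = {z | ∀ y, hbar z ≤ hbar y})
    (hXne : X.Nonempty)
    (hstar : ℝ)
    (hhstar : IsGLB (Set.range hbar) hstar)
    (xstar : EuclideanSpace ℝ (Fin n))
    (hxstar_mem : xstar ∈ X)
    (hxstar_min : ∀ y ∈ X, fbar xstar ≤ fbar y)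
    (x : ℕ → EuclideanSpace ℝ (Fin n))
    (η : ℕ → ℝ) (γ : ℝ)
    (hη_pos : ∀ k, 0 < η k)
    (hη_mono : ∀ k, η (k+1) ≤ η k)
    (hγ_pos : 0 < γ)
    (hγ_le : γ ≤ 1 / (Lh + η 0 * Lf))
    (hx_iter : ∀ k u,
      ωh (x (k+1)) + η k * ωf (x (k+1))
        + 1 / (2*γ) * ‖x (k+1) - (x k - γ • (h' (x k) + η k • f' (x k)))‖ ^ 2
      ≤ ωh u + η k * ωf u
        + 1 / (2*γ) * ‖u - (x k - γ • (h' (x k) + η k • f' (x k)))‖ ^ 2)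
    :
    ∀ k : ℕ,
      η k * (fbar (x (k+1)) - fbar xstar) + (hbar (x (k+1)) - hstar)
        ≤ 1 / (2*γ) * ((1 - η k * γ * μf) * ‖x k - xstar‖ ^ 2
            - ‖x (k+1) - xstar‖ ^ 2) := by
  intro k
  have hη_le : η k ≤ η 0 := antitone_nat_of_succ_le hη_mono (Nat.zero_le k)
  have hLf_pos : 0 < Lf := hμf_pos.trans_le hμf_le
  have hstep : Lh + η k * Lf ≤ 1 / γ := by
    have hpos : 0 < Lh + η 0 * Lf := by have := hη_pos 0; positivity
    have h0 : Lh + η 0 * Lf ≤ 1 / γ := (le_one_div hγ_pos hpos).1 hγ_le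
    have := mul_le_mul_of_nonneg_right hη_le hLf_pos.le
    linarith
  have hstar_eq : hstar = hbar xstar := by
    rw [hX] at hxstar_mem
    refine le_antisymm (hhstar.1 ⟨xstar, rfl⟩) (hhstar.2 ?_)
    rintro _ ⟨y, rfl⟩
    exact hxstar_mem y
  have hη := (hη_pos k).le
  have hω : ConvexOn ℝ Set.univ fun u => ωh u + η k * ωf u :=
    hωh_conv.add (hωf_conv.smul hη)
  have hprox := hω.prox_three_point (hx_iter k) xstar
  have hexpand (u : EuclideanSpace ℝ (Fin n)) :
      1 / (2 * γ) * ‖u - (x k - γ • (h' (x k) + η k • f' (x k)))‖ ^ 2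
        = 1 / (2 * γ) * ‖u - x k‖ ^ 2 + (⟪h' (x k), u - x k⟫ + η k * ⟪f' (x k), u - x k⟫)
          + γ / 2 * ‖h' (x k) + η k • f' (x k)‖ ^ 2 := by
    rw [show u - (x k - γ • (h' (x k) + η k • f' (x k)))
        = (u - x k) + γ • (h' (x k) + η k • f' (x k)) by abel, norm_add_sq_real,
      real_inner_smul_right, norm_smul, mul_pow, Real.norm_eq_abs, sq_abs, real_inner_comm,
      inner_add_left, real_inner_smul_left]
    field_simp
  rw [hexpand, hexpand] at hprox
  have hh_up := le_add_inner_gradient_of_lipschitz hh_grad hh_lip (x k) (x (k + 1))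
  have hf_up := mul_le_mul_of_nonneg_left
    (le_add_inner_gradient_of_lipschitz hf_grad hf_lip (x k) (x (k + 1))) hη
  have hh_low := hh_conv.add_inner_gradient_le (hh_grad (x k)) xstar
  have hf_low := mul_le_mul_of_nonneg_left
    (hf_sc.add_inner_gradient_le (hf_grad (x k)) xstar) hη
  have hquad := mul_le_mul_of_nonneg_right hstep (sq_nonneg ‖x (k + 1) - x k‖)
  have hhalf : 1 / (2 * γ) = 1 / γ / 2 := by field_simp
  have hrhs : 1 / (2 * γ) * ((1 - η k * γ * μf) * ‖x k - xstar‖ ^ 2 - ‖x (k + 1) - xstar‖ ^ 2)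
      = 1 / γ / 2 * ‖x k - xstar‖ ^ 2 - η k * μf / 2 * ‖x k - xstar‖ ^ 2
        - 1 / γ / 2 * ‖x (k + 1) - xstar‖ ^ 2 := by
    field_simp
  rw [hrhs, hstar_eq, hfbar, hfbar, hhbar, hhbar]
  rw [hhalf, norm_sub_rev xstar (x (k + 1)), norm_sub_rev xstar (x k)] at hprox
  rw [norm_sub_rev xstar (x k)] at hf_low
  linarith
end
end

section
/- Let (x_k) be the IR-ISTA iterates with weights θ_k := 1/∏_{t=0}^{k}(1 − η_t γ μ_f) and averaged iterates x̄_K := (Σ_{k=0}^{K−1} θ_k η_k x_{k+1})/(Σ_{k=0}^{K−1} θ_k η_k). Then for every K ≥ 1: −‖∇̃f̄(x*)‖·dist(x̄_K, X*_h̄) + (μ_f/2)‖x̄_K − x*‖² ≤ f̄(x̄_K) − f̄* ≤ ‖x_0 − x*‖²/(2γ·Σ_{j=0}^{K−1} θ_j η_j). -/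
open scoped RealInnerProductSpace
open Metric Filter

noncomputable section

section InnerProductSpace

variable {E : Type*} [NormedAddCommGroup E] [InnerProductSpace ℝ E]

/-- A subgradient of a strongly convex function satisfies the quadratically strengthened
subgradient inequality. -/
theorem StrongConvexOn.add_inner_add_sq_le {m : ℝ} {φ : E → ℝ}
    (hφ : StrongConvexOn Set.univ m φ) {x g : E}
    (hg : ∀ y, φ x + ⟪g, y - x⟫ ≤ φ y) (y : E) :
    φ x + ⟪g, y - x⟫ + m / 2 * ‖y - x‖ ^ 2 ≤ φ y := by
  have key : ∀ t ∈ Set.Ioo (0 : ℝ) 1,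
      φ x + ⟪g, y - x⟫ + (1 - t) * (m / 2 * ‖y - x‖ ^ 2) ≤ φ y := by
    rintro t ⟨ht0, ht1⟩
    have hc := hφ.2 (Set.mem_univ x) (Set.mem_univ y) (sub_nonneg.2 ht1.le) ht0.le (by ring)
    have hs := hg ((1 - t) • x + t • y)
    rw [show (1 - t) • x + t • y - x = t • (y - x) by module, inner_smul_right] at hs
    rw [norm_sub_rev] at hc
    simp only [smul_eq_mul] at hc
    refine le_of_mul_le_mul_left ?_ ht0
    linarith
  have hlim : Tendsto (fun t : ℝ => φ x + ⟪g, y - x⟫ + (1 - t) * (m / 2 * ‖y - x‖ ^ 2))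
      (nhdsWithin 0 (Set.Ioi 0)) (nhds (φ x + ⟪g, y - x⟫ + m / 2 * ‖y - x‖ ^ 2)) := by
    have hcont : Continuous fun t : ℝ =>
        φ x + ⟪g, y - x⟫ + (1 - t) * (m / 2 * ‖y - x‖ ^ 2) := by fun_prop
    simpa using (hcont.tendsto 0).mono_left nhdsWithin_le_nhds
  refine le_of_tendsto hlim ?_
  filter_upwards [Ioo_mem_nhdsGT one_pos] with t ht using key t ht

theorem strongConvexOn_norm_sub_sq (c : ℝ) (v : E) :
    StrongConvexOn Set.univ (2 * c) fun u => c * ‖u - v‖ ^ 2 := by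
  refine ⟨convex_univ, fun x _ y _ a b _ _ hab => le_of_eq ?_⟩
  obtain rfl : a = 1 - b := by linarith
  have h₁ : (1 - b) • x + b • y - v = (1 - b) • (x - v) + b • (y - v) := by module
  have h₂ : x - y = (x - v) - (y - v) := by abel
  simp only [h₁, h₂, smul_eq_mul]
  rw [norm_add_sq_real, norm_sub_sq_real (x - v), norm_smul, norm_smul, inner_smul_left,
    inner_smul_right, mul_pow, mul_pow, Real.norm_eq_abs, Real.norm_eq_abs, sq_abs, sq_abs]
  simp only [conj_trivial]
  ring

/-- The minimizer `p` of `w + c * ‖· - v‖ ^ 2` satisfies the three-point inequality. -/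
theorem ConvexOn.add_norm_sub_sq_le_of_isMin {w : E → ℝ} (hw : ConvexOn ℝ Set.univ w)
    {c : ℝ} {v p : E}
    (hp : ∀ u, w p + c * ‖p - v‖ ^ 2 ≤ w u + c * ‖u - v‖ ^ 2) (u : E) :
    w p + c * ‖p - v‖ ^ 2 + c * ‖u - p‖ ^ 2 ≤ w u + c * ‖u - v‖ ^ 2 := by
  have hsc := (strongConvexOn_zero.2 hw).add (strongConvexOn_norm_sub_sq c v)
  have hsc' : StrongConvexOn Set.univ (2 * c) (w + fun u => c * ‖u - v‖ ^ 2) := by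
    refine hsc.mono fun r => ?_
    simp
  have := hsc'.add_inner_add_sq_le (x := p) (g := 0) (by simpa using hp) u
  simp only [inner_zero_left, Pi.add_apply, add_zero] at this
  linarith

variable [CompleteSpace E]

theorem HasGradientAt.hasDerivAt_comp_add_smul {φ : E → ℝ} {g x d : E} {t : ℝ}
    (h : HasGradientAt φ g (x + t • d)) :
    HasDerivAt (fun s : ℝ => φ (x + s • d)) ⟪g, d⟫ t := by
  have hd : HasDerivAt (fun s : ℝ => x + s • d) d t := by
    simpa using ((hasDerivAt_id t).smul_const d).const_add x
  simpa using! h.hasFDerivAt.comp_hasDerivAt t hd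

/-- The first-order characterization of convexity. -/
theorem ConvexOn.add_inner_le_of_hasGradientAt {φ : E → ℝ} (hφ : ConvexOn ℝ Set.univ φ)
    {g x : E} (hg : HasGradientAt φ g x) (y : E) : φ x + ⟪g, y - x⟫ ≤ φ y := by
  have hc : ConvexOn ℝ Set.univ fun s : ℝ => φ (x + s • (y - x)) := by
    have := hφ.comp_affineMap (AffineMap.lineMap x y : ℝ →ᵃ[ℝ] E)
    simpa [Function.comp_def, AffineMap.lineMap_apply, add_comm] using this
  have hd : HasDerivAt (fun s : ℝ => φ (x + s • (y - x))) ⟪g, y - x⟫ 0 :=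
    HasGradientAt.hasDerivAt_comp_add_smul (by simpa using hg)
  have := hc.le_slope_of_hasDerivAt (Set.mem_univ 0) (Set.mem_univ 1) one_pos hd
  simp [slope_def_field] at this
  linarith

/-- The descent lemma for functions with Lipschitz gradient. -/
theorem le_add_inner_add_sq_of_lipschitz_gradient {φ : E → ℝ} {φ' : E → E} {L : ℝ}
    (hg : ∀ x, HasGradientAt φ (φ' x) x) (hL : ∀ x y, ‖φ' x - φ' y‖ ≤ L * ‖x - y‖) (x y : E) :
    φ y ≤ φ x + ⟪φ' x, y - x⟫ + L / 2 * ‖y - x‖ ^ 2 := by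
  set d := y - x with hd
  have hder : ∀ t : ℝ, HasDerivAt
      (fun s : ℝ => φ (x + s • d) - s * ⟪φ' x, d⟫ - s ^ 2 * (L / 2 * ‖d‖ ^ 2))
      (⟪φ' (x + t • d), d⟫ - ⟪φ' x, d⟫ - 2 * t * (L / 2 * ‖d‖ ^ 2)) t := by
    intro t
    have h₁ := (hg (x + t • d)).hasDerivAt_comp_add_smul
    have h₂ := (hasDerivAt_id t).mul_const ⟪φ' x, d⟫
    have h₃ := (hasDerivAt_pow 2 t).mul_const (L / 2 * ‖d‖ ^ 2)
    simpa using! (h₁.sub h₂).sub h₃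
  have hanti := antitoneOn_of_deriv_nonpos (convex_Icc (0 : ℝ) 1)
    (fun t _ => (hder t).continuousAt.continuousWithinAt)
    (fun t _ => (hder t).differentiableAt.differentiableWithinAt) (fun t ht => by
      rw [interior_Icc] at ht
      rw [(hder t).deriv, ← inner_sub_left]
      have h₁ := real_inner_le_norm (φ' (x + t • d) - φ' x) d
      have h₂ := hL (x + t • d) x
      rw [add_sub_cancel_left, norm_smul, Real.norm_of_nonneg ht.1.le] at h₂
      nlinarith [mul_le_mul_of_nonneg_right h₂ (norm_nonneg d)])
  have := hanti (Set.left_mem_Icc.2 zero_le_one) (Set.right_mem_Icc.2 zero_le_one) zero_le_one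
  simp [hd] at this
  linarith

/-- One step of the proximal gradient method applied to `F + w`. -/
theorem proximal_gradient_step {F w : E → ℝ} {F' : E → E} {L m γ : ℝ} {x p : E}
    (hg : ∀ x, HasGradientAt F (F' x) x) (hL : ∀ x y, ‖F' x - F' y‖ ≤ L * ‖x - y‖)
    (hm : 0 ≤ m) (hF : StrongConvexOn Set.univ m F) (hw : ConvexOn ℝ Set.univ w)
    (hγ : 0 < γ) (hγL : L * γ ≤ 1)
    (hp : ∀ u, w p + 1 / (2 * γ) * ‖p - (x - γ • F' x)‖ ^ 2
      ≤ w u + 1 / (2 * γ) * ‖u - (x - γ • F' x)‖ ^ 2) (u : E) :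
    2 * γ * (F p + w p - (F u + w u)) ≤ (1 - m * γ) * ‖x - u‖ ^ 2 - ‖p - u‖ ^ 2 := by
  have h₁ := hw.add_norm_sub_sq_le_of_isMin hp u
  have h₂ := le_add_inner_add_sq_of_lipschitz_gradient hg hL x p
  have hFc : ConvexOn ℝ Set.univ F :=
    strongConvexOn_zero.1 (hF.mono hm)
  have h₃ := hF.add_inner_add_sq_le (hFc.add_inner_le_of_hasGradientAt (hg x)) u
  have expand : ∀ z, ‖z - (x - γ • F' x)‖ ^ 2
      = ‖z - x‖ ^ 2 + 2 * γ * ⟪F' x, z - x⟫ + ‖γ • F' x‖ ^ 2 := by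
    intro z
    rw [show z - (x - γ • F' x) = (z - x) + γ • F' x by abel, norm_add_sq_real,
      inner_smul_right, real_inner_comm]
    ring
  rw [expand, expand] at h₁
  have h₄ := mul_le_mul_of_nonneg_left h₁ (by positivity : 0 ≤ 2 * γ)
  have hc : 2 * γ * (1 / (2 * γ)) = 1 := by field_simp
  have h₅ : 2 * γ * w p + ‖p - x‖ ^ 2 + 2 * γ * ⟪F' x, p - x⟫ + ‖u - p‖ ^ 2
      ≤ 2 * γ * w u + ‖u - x‖ ^ 2 + 2 * γ * ⟪F' x, u - x⟫ := by
    linear_combination h₄ + (‖u - x‖ ^ 2 + 2 * γ * ⟪F' x, u - x⟫ - ‖u - p‖ ^ 2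
      - ‖p - x‖ ^ 2 - 2 * γ * ⟪F' x, p - x⟫) * hc
  have h₆ := mul_le_mul_of_nonneg_left h₂ (by positivity : 0 ≤ 2 * γ)
  have h₇ := mul_le_mul_of_nonneg_left h₃ (by positivity : 0 ≤ 2 * γ)
  have h₈ := mul_le_mul_of_nonneg_right hγL (sq_nonneg ‖p - x‖)
  rw [norm_sub_rev x u, norm_sub_rev p u]
  linarith

end InnerProductSpace

theorem stmt_9
    {n : ℕ}
    (f h ωf ωh : EuclideanSpace ℝ (Fin n) → ℝ)
    (f' h' : EuclideanSpace ℝ (Fin n) → EuclideanSpace ℝ (Fin n))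
    (Lf Lh μf : ℝ)
    (hμf_pos : 0 < μf) (hμf_le : μf ≤ Lf) (hLh_pos : 0 < Lh)
    (hf_grad : ∀ x, HasGradientAt f (f' x) x)
    (hf_lip : ∀ x y, ‖f' x - f' y‖ ≤ Lf * ‖x - y‖)
    (hf_sc : StrongConvexOn Set.univ μf f)
    (hh_grad : ∀ x, HasGradientAt h (h' x) x)
    (hh_lip : ∀ x y, ‖h' x - h' y‖ ≤ Lh * ‖x - y‖)
    (hh_conv : ConvexOn ℝ Set.univ h)
    (hωf_conv : ConvexOn ℝ Set.univ ωf)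
    (hωh_conv : ConvexOn ℝ Set.univ ωh)
    (fbar hbar : EuclideanSpace ℝ (Fin n) → ℝ)
    (hfbar : ∀ x, fbar x = f x + ωf x)
    (hhbar : ∀ x, hbar x = h x + ωh x)
    (X : Set (EuclideanSpace ℝ (Fin n)))
    (hX : X = {z | ∀ y, hbar z ≤ hbar y})
    (hXne : X.Nonempty)
    (hstar : ℝ)
    (hhstar : IsGLB (Set.range hbar) hstar)
    (xstar : EuclideanSpace ℝ (Fin n))
    (hxstar_mem : xstar ∈ X)
    (hxstar_min : ∀ y ∈ X, fbar xstar ≤ fbar y)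
    (g : EuclideanSpace ℝ (Fin n))
    (hg_sub : ∀ y, fbar xstar + ⟪g, y - xstar⟫ ≤ fbar y)
    (hg_opt : ∀ y ∈ X, (0:ℝ) ≤ ⟪g, y - xstar⟫)
    (x : ℕ → EuclideanSpace ℝ (Fin n))
    (η : ℕ → ℝ) (γ : ℝ)
    (hη_pos : ∀ k, 0 < η k)
    (hη_mono : ∀ k, η (k+1) ≤ η k)
    (hγ_pos : 0 < γ)
    (hγ_le : γ ≤ 1 / (Lh + η 0 * Lf))
    (hx_iter : ∀ k u,
      ωh (x (k+1)) + η k * ωf (x (k+1))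
        + 1 / (2*γ) * ‖x (k+1) - (x k - γ • (h' (x k) + η k • f' (x k)))‖ ^ 2
      ≤ ωh u + η k * ωf u
        + 1 / (2*γ) * ‖u - (x k - γ • (h' (x k) + η k • f' (x k)))‖ ^ 2)
    (θ : ℕ → ℝ)
    (hθ : ∀ k, θ k = 1 / ∏ t ∈ Finset.range (k+1), (1 - η t * γ * μf))
    (xbar : ℕ → EuclideanSpace ℝ (Fin n))
    (hxbar : ∀ K, xbar K = (∑ j ∈ Finset.range K, θ j * η j)⁻¹ •
        ∑ k ∈ Finset.range K, (θ k * η k) • x (k+1))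
    :
    ∀ K : ℕ, 1 ≤ K →
      (-‖g‖ * Metric.infDist (xbar K) X + μf / 2 * ‖xbar K - xstar‖ ^ 2
          ≤ fbar (xbar K) - fbar xstar)
      ∧ fbar (xbar K) - fbar xstar
          ≤ ‖x 0 - xstar‖ ^ 2 / (2 * γ * ∑ j ∈ Finset.range K, θ j * η j) := by
  intro K hK
  have hLf : 0 < Lf := hμf_pos.trans_le hμf_le
  have hη_le : ∀ k, η k ≤ η 0 := fun k => antitone_nat_of_succ_le hη_mono (Nat.zero_le k)
  have hγ' : γ * (Lh + η 0 * Lf) ≤ 1 :=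
    (le_div_iff₀ (add_pos hLh_pos (mul_pos (hη_pos 0) hLf))).1 hγ_le
  have hγk : ∀ k, (Lh + η k * Lf) * γ ≤ 1 := fun k => by
    nlinarith [mul_le_mul_of_nonneg_right (hη_le k) (mul_pos hLf hγ_pos).le]
  have hfac : ∀ k, 0 < 1 - η k * γ * μf := fun k => by
    nlinarith [hγk k, mul_pos hLh_pos hγ_pos,
      mul_le_mul_of_nonneg_left hμf_le (mul_pos (hη_pos k) hγ_pos).le]
  have hprod : ∀ k, 0 < ∏ t ∈ Finset.range k, (1 - η t * γ * μf) :=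
    fun k => Finset.prod_pos fun t _ => hfac t
  have hθ_pos : ∀ k, 0 < θ k := fun k => by
    rw [hθ]; exact one_div_pos.2 (hprod _)
  have hfbar_sc : StrongConvexOn Set.univ μf fbar := by
    have h₁ : UniformConvexOn Set.univ _ (f + ωf) := hf_sc.add (strongConvexOn_zero.2 hωf_conv)
    rw [show fbar = f + ωf from funext hfbar]
    refine h₁.mono fun r => ?_
    simp
  refine ⟨?_, ?_⟩
  · have h₁ := hfbar_sc.add_inner_add_sq_le hg_sub (xbar K)
    have h₂ : -⟪g, xbar K - xstar⟫ ≤ ‖g‖ * Metric.infDist (xbar K) X := by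
      rcases (norm_nonneg g).eq_or_lt with h0 | h0
      · simp [norm_eq_zero.1 h0.symm]
      rw [← div_le_iff₀' h0, Metric.le_infDist hXne]
      intro p hp
      rw [div_le_iff₀' h0, dist_eq_norm]
      have h₃ := hg_opt p hp
      have h₄ := (abs_le.1 (abs_real_inner_le_norm g (xbar K - p))).1
      have h₅ : ⟪g, xbar K - xstar⟫ = ⟪g, xbar K - p⟫ + ⟪g, p - xstar⟫ := by
        rw [← inner_add_right, sub_add_sub_cancel]
      linarith
    linarith
  · have hstep : ∀ k, 2 * γ * (η k * (fbar (x (k + 1)) - fbar xstar))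
        ≤ (1 - η k * γ * μf) * ‖x k - xstar‖ ^ 2 - ‖x (k + 1) - xstar‖ ^ 2 := by
      intro k
      have hF := proximal_gradient_step (F := fun z => h z + η k * f z)
        (w := fun z => ωh z + η k * ωf z) (F' := fun z => h' z + η k • f' z)
        (L := Lh + η k * Lf) (m := η k * μf) (γ := γ) (x := x k) (p := x (k + 1))
        (fun z => by
          rw [hasGradientAt_iff_hasFDerivAt]
          simpa using! (hh_grad z).hasFDerivAt.add ((hf_grad z).hasFDerivAt.const_mul (η k)))
        (fun y z => by
          rw [show h' y + η k • f' y - (h' z + η k • f' z)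
            = (h' y - h' z) + η k • (f' y - f' z) by module]
          refine (norm_add_le _ _).trans ?_
          rw [norm_smul, Real.norm_of_nonneg (hη_pos k).le]
          nlinarith [hh_lip y z, mul_le_mul_of_nonneg_left (hf_lip y z) (hη_pos k).le])
        (mul_pos (hη_pos k) hμf_pos).le
        ⟨convex_univ, fun y hy z hz a b ha hb hab => by
          have h₁ := hh_conv.2 hy hz ha hb hab
          have h₂ := mul_le_mul_of_nonneg_left (hf_sc.2 hy hz ha hb hab) (hη_pos k).le
          simp only [smul_eq_mul] at h₁ h₂ ⊢
          linarith⟩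
        (hωh_conv.add (hωf_conv.smul (hη_pos k).le)) hγ_pos (hγk k) (hx_iter k) xstar
      have hmin : hbar xstar ≤ hbar (x (k + 1)) := by
        rw [hX] at hxstar_mem
        exact hxstar_mem _
      rw [hhbar, hhbar] at hmin
      have := mul_le_mul_of_nonneg_left hmin (by positivity : 0 ≤ 2 * γ)
      rw [hfbar, hfbar]
      linarith
    have hθ_succ : ∀ k, θ (k + 1) * (1 - η (k + 1) * γ * μf) = θ k := fun k => by
      rw [hθ, hθ, Finset.prod_range_succ _ (k + 1), one_div, one_div, mul_inv, mul_assoc,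
        inv_mul_cancel₀ (hfac (k + 1)).ne', mul_one]
    have hθ_zero : θ 0 * (1 - η 0 * γ * μf) = 1 := by
      rw [hθ]
      simpa using inv_mul_cancel₀ (hfac 0).ne'
    have htel : ∀ k, 2 * γ * ∑ j ∈ Finset.range (k + 1),
          θ j * η j * (fbar (x (j + 1)) - fbar xstar)
        ≤ ‖x 0 - xstar‖ ^ 2 - θ k * ‖x (k + 1) - xstar‖ ^ 2 := by
      intro k
      induction k with
      | zero =>
        have := mul_le_mul_of_nonneg_left (hstep 0) (hθ_pos 0).le
        rw [Finset.sum_range_one]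
        linear_combination this + ‖x 0 - xstar‖ ^ 2 * hθ_zero
      | succ k ih =>
        have := mul_le_mul_of_nonneg_left (hstep (k + 1)) (hθ_pos (k + 1)).le
        rw [Finset.sum_range_succ]
        linear_combination this + ih + ‖x (k + 1) - xstar‖ ^ 2 * hθ_succ k
    obtain ⟨k, rfl⟩ : ∃ k, K = k + 1 := ⟨K - 1, by omega⟩
    have hw_pos : ∀ j, 0 < θ j * η j := fun j => mul_pos (hθ_pos j) (hη_pos j)
    have hS : 0 < ∑ j ∈ Finset.range (k + 1), θ j * η j :=
      Finset.sum_pos (fun j _ => hw_pos j) ⟨0, by simp⟩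
    have hfbar_conv : ConvexOn ℝ Set.univ fbar :=
      strongConvexOn_zero.1 (hfbar_sc.mono hμf_pos.le)
    have hJ := hfbar_conv.map_centerMass_le (t := Finset.range (k + 1))
      (w := fun j => θ j * η j) (p := fun j => x (j + 1)) (fun j _ => (hw_pos j).le) hS
      (fun _ _ => Set.mem_univ _)
    simp only [Finset.centerMass, ← hxbar, Function.comp_apply, smul_eq_mul] at hJ
    rw [← div_eq_inv_mul, le_div_iff₀ hS] at hJ
    have hk := htel k
    simp only [mul_sub, Finset.sum_sub_distrib, ← Finset.sum_mul] at hk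
    rw [le_div_iff₀ (by positivity)]
    have h₁ := mul_le_mul_of_nonneg_left hJ (by positivity : 0 ≤ 2 * γ)
    have h₂ := mul_nonneg (hθ_pos k).le (sq_nonneg ‖x (k + 1) - xstar‖)
    linarith
end
end

section
/- Under the diminishing regularization choice (μ_f < 2L_f, γ ≤ 1/(2L_h), η_{0,u} := 1/(γμ_f), η_{0,l} := 2L_f/μ_f, η_k := η_{0,u}/(η_{0,l}+k)), the IR-ISTA averaged iterates satisfy, for every K ≥ 1: 0 ≤ h̄(x̄_K) − h̄* ≤ u_{2,K}/K, where u_{2,K} := γ(2L_f − μ_f)·( η_0‖x_0 − x*‖²/(2γ) + (f̄* − Ĉ_f̄)·(η_{0,u}²/(η_{0,l}−1))·(η_{0,l} + ln((K + η_{0,l} − 1)/η_{0,l})) ). -/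
open scoped RealInnerProductSpace
open Metric Filter

noncomputable section

section InnerProductSpace

variable {E : Type*} [NormedAddCommGroup E] [InnerProductSpace ℝ E]

lemma hasDerivAt_comp_line [CompleteSpace E] {f : E → ℝ} {f' : E → E}
    (hf : ∀ x, HasGradientAt f (f' x) x) (x d : E) (t : ℝ) :
    HasDerivAt (fun s : ℝ ↦ f (x + s • d)) ⟪f' (x + t • d), d⟫ t := by
  have hline : HasDerivAt (fun s : ℝ ↦ x + s • d) d t := by
    simpa using ((hasDerivAt_id t).smul_const d).const_add x
  simpa [Function.comp_def] using! (hf (x + t • d)).hasFDerivAt.comp_hasDerivAt t hline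

/-- The quadratic lower bound at a point of differentiability of a strongly convex function. -/
lemma StrongConvexOn.add_inner_add_le [CompleteSpace E] {f : E → ℝ} {f' : E → E} {m : ℝ}
    (hsc : StrongConvexOn Set.univ m f) (hf : ∀ x, HasGradientAt f (f' x) x) (x y : E) :
    f x + ⟪f' x, y - x⟫ + m / 2 * ‖y - x‖ ^ 2 ≤ f y := by
  have hconv := (strongConvexOn_iff_convex.1 hsc).comp_affineMap (AffineMap.lineMap x y)
  have hsq : HasDerivAt (fun s : ℝ ↦ m / 2 * ‖x + s • (y - x)‖ ^ 2)
      (m / 2 * (2 * ⟪x, y - x⟫)) 0 := by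
    have hline : HasDerivAt (fun s : ℝ ↦ x + s • (y - x)) (y - x) 0 := by
      simpa using ((hasDerivAt_id (0 : ℝ)).smul_const (y - x)).const_add x
    simpa using hline.norm_sq.const_mul (m / 2)
  have hderiv := (hasDerivAt_comp_line hf x (y - x) 0).sub hsq
  have hslope := hconv.le_slope_of_hasDerivAt (x := 0) (y := 1) (by simp) (by simp) one_pos
    (f' := ⟪f' x, y - x⟫ - m / 2 * (2 * ⟪x, y - x⟫))
    (by simpa [Function.comp_def, Pi.sub_def, AffineMap.lineMap_apply, add_comm] using! hderiv)
  simp only [slope_def_field, Function.comp_apply, AffineMap.lineMap_apply_zero,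
    AffineMap.lineMap_apply_one, sub_zero, div_one] at hslope
  have hnorm : ‖y - x‖ ^ 2 = ‖y‖ ^ 2 - 2 * ⟪x, y - x⟫ - ‖x‖ ^ 2 := by
    rw [norm_sub_sq_real, inner_sub_right, real_inner_self_eq_norm_sq, real_inner_comm]
    ring
  rw [hnorm]
  linarith

/-- The descent lemma for a function with Lipschitz gradient. -/
lemma le_add_inner_add_of_lipschitz_gradient [CompleteSpace E] {f : E → ℝ} {f' : E → E} {L : ℝ}
    (hf : ∀ x, HasGradientAt f (f' x) x) (hL : ∀ x y, ‖f' x - f' y‖ ≤ L * ‖x - y‖) (x y : E) :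
    f y ≤ f x + ⟪f' x, y - x⟫ + L / 2 * ‖y - x‖ ^ 2 := by
  set d := y - x with hd
  have hderiv : ∀ t : ℝ, HasDerivAt
      (fun s : ℝ ↦ f (x + s • d) - s * ⟪f' x, d⟫ - L / 2 * ‖d‖ ^ 2 * s ^ 2)
      (⟪f' (x + t • d), d⟫ - ⟪f' x, d⟫ - L / 2 * ‖d‖ ^ 2 * (2 * t)) t := by
    intro t
    simpa [Pi.sub_def] using! ((hasDerivAt_comp_line hf x d t).sub
      ((hasDerivAt_id t).mul_const ⟪f' x, d⟫)).sub
      ((hasDerivAt_pow 2 t).const_mul (L / 2 * ‖d‖ ^ 2))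
  have hanti := antitoneOn_of_deriv_nonpos (convex_Icc (0 : ℝ) 1)
    (fun t _ ↦ (hderiv t).continuousAt.continuousWithinAt)
    (fun t _ ↦ (hderiv t).differentiableAt.differentiableWithinAt)
    (fun t ht ↦ by
      rw [interior_Icc] at ht
      rw [(hderiv t).deriv, ← inner_sub_left]
      have hlip := hL (x + t • d) x
      rw [add_sub_cancel_left, norm_smul, Real.norm_of_nonneg ht.1.le] at hlip
      have hcs := real_inner_le_norm (f' (x + t • d) - f' x) d
      nlinarith [mul_le_mul_of_nonneg_right hlip (norm_nonneg d)])
  have := hanti (by simp) (by simp) zero_le_one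
  simp only [one_smul, zero_smul, add_zero, hd, add_sub_cancel] at this
  linarith

/-- The three-point inequality for a proximal step on a convex function. -/
lemma ConvexOn.add_norm_sq_add_norm_sq_le_of_isMinimizer {φ : E → ℝ} {c : ℝ} {p y : E}
    (hφ : ConvexOn ℝ Set.univ φ)
    (hp : ∀ u, φ p + c * ‖p - y‖ ^ 2 ≤ φ u + c * ‖u - y‖ ^ 2) (u : E) :
    φ p + c * ‖p - y‖ ^ 2 + c * ‖u - p‖ ^ 2 ≤ φ u + c * ‖u - y‖ ^ 2 := by
  have hsmall : ∀ t ∈ Set.Ioo (0 : ℝ) 1,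
      φ p - φ u ≤ 2 * c * ⟪p - y, u - p⟫ + t * (c * ‖u - p‖ ^ 2) := by
    rintro t ⟨ht0, ht1⟩
    have hconv := hφ.2 (Set.mem_univ p) (Set.mem_univ u) (sub_nonneg.2 ht1.le) ht0.le
      (sub_add_cancel 1 t)
    have hmin := hp ((1 - t) • p + t • u)
    have hpt : (1 - t) • p + t • u - y = (p - y) + t • (u - p) := by module
    rw [hpt, norm_add_sq_real, inner_smul_right, norm_smul, Real.norm_of_nonneg ht0.le] at hmin
    simp only [smul_eq_mul] at hconv
    refine le_of_mul_le_mul_left ?_ ht0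
    linarith
  have hlim : φ p - φ u ≤ 2 * c * ⟪p - y, u - p⟫ := by
    have htendsto : Tendsto (fun t : ℝ ↦ 2 * c * ⟪p - y, u - p⟫ + t * (c * ‖u - p‖ ^ 2))
        (nhdsWithin 0 (Set.Ioi 0)) (nhds (2 * c * ⟪p - y, u - p⟫ + 0 * (c * ‖u - p‖ ^ 2))) :=
      (Continuous.tendsto (by fun_prop) 0).mono_left nhdsWithin_le_nhds
    have := ge_of_tendsto htendsto
      (Filter.mem_of_superset (Ioo_mem_nhdsGT one_pos) hsmall)
    linarith
  have hu : u - y = (p - y) + (u - p) := by abel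
  rw [hu, norm_add_sq_real]
  linarith

end InnerProductSpace

lemma sum_range_one_div_add_le {l : ℝ} (hl : 0 < l) (n : ℕ) :
    ∑ k ∈ Finset.range (n + 1), 1 / (l + k) ≤ 1 / l + Real.log ((n + l) / l) := by
  induction n with
  | zero => simp [hl.ne']
  | succ n ih =>
    rw [Finset.sum_range_succ]
    have hn : 0 < n + l := by positivity
    have hn' : 0 < (n : ℝ) + 1 + l := by positivity
    have hlog := Real.one_sub_inv_le_log_of_pos (div_pos hn' hn)
    have hinv : 1 - ((n + 1 + l) / (n + l))⁻¹ = 1 / (l + ((n + 1 : ℕ) : ℝ)) := by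
      have : l + ((n : ℝ) + 1) ≠ 0 := by positivity
      push_cast
      field_simp
      ring
    have hsplit : Real.log ((n + 1 + l) / l)
        = Real.log ((n + l) / l) + Real.log ((n + 1 + l) / (n + l)) := by
      rw [← Real.log_mul (by positivity) (by positivity)]
      congr 1
      field_simp
    rw [hinv] at hlog
    push_cast at hlog ih ⊢
    rw [hsplit]
    linarith

lemma one_div_prod_range_one_sub_one_div_add {l : ℝ} (hl : 1 < l) (k : ℕ) :
    1 / ∏ t ∈ Finset.range (k + 1), (1 - 1 / (l + t)) = (l + k) / (l - 1) := by
  have hl1 : l - 1 ≠ 0 := (sub_pos.2 hl).ne'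
  have hpos : ∀ t : ℕ, l + (t : ℝ) ≠ 0 := fun t ↦ by positivity
  have hprod : ∏ t ∈ Finset.range (k + 1), (1 - 1 / (l + t)) = (l - 1) / (l + k) := by
    induction k with
    | zero =>
      have := hpos 0
      simp only [Nat.cast_zero, add_zero] at this
      simp
      field_simp
    | succ k ih =>
      rw [Finset.prod_range_succ, ih]
      have h1 := hpos k
      have h2 := hpos (k + 1)
      push_cast at h2 ⊢
      field_simp
      ring
  rw [hprod, one_div_div]

/-- One proximal-gradient step on `h + ωh + η (f + ωf)`. -/
lemma proximal_gradient_step_s13 {E : Type*} [NormedAddCommGroup E] [InnerProductSpace ℝ E]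
    [CompleteSpace E] {f h ωf ωh : E → ℝ} {f' h' : E → E} {Lf Lh μf γ η : ℝ}
    (hf_grad : ∀ x, HasGradientAt f (f' x) x)
    (hf_lip : ∀ x y, ‖f' x - f' y‖ ≤ Lf * ‖x - y‖)
    (hf_sc : StrongConvexOn Set.univ μf f)
    (hh_grad : ∀ x, HasGradientAt h (h' x) x)
    (hh_lip : ∀ x y, ‖h' x - h' y‖ ≤ Lh * ‖x - y‖)
    (hh_conv : ConvexOn ℝ Set.univ h)
    (hωf_conv : ConvexOn ℝ Set.univ ωf)
    (hωh_conv : ConvexOn ℝ Set.univ ωh)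
    (hη : 0 ≤ η) (hγ : 0 < γ) (hγη : Lh + η * Lf ≤ 1 / γ) {x p : E}
    (hp : ∀ u, ωh p + η * ωf p + 1 / (2 * γ) * ‖p - (x - γ • (h' x + η • f' x))‖ ^ 2
      ≤ ωh u + η * ωf u + 1 / (2 * γ) * ‖u - (x - γ • (h' x + η • f' x))‖ ^ 2) (u : E) :
    h p + ωh p + η * (f p + ωf p) + 1 / (2 * γ) * ‖u - p‖ ^ 2
      ≤ h u + ωh u + η * (f u + ωf u) + 1 / (2 * γ) * ((1 - η * γ * μf) * ‖u - x‖ ^ 2) := by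
  have hprox := (hωh_conv.add (hωf_conv.smul hη)).add_norm_sq_add_norm_sq_le_of_isMinimizer
    (c := 1 / (2 * γ)) (y := x - γ • (h' x + η • f' x)) hp u
  simp only [Pi.add_apply, smul_eq_mul] at hprox
  have hexp : ∀ v : E, 1 / (2 * γ) * ‖v - (x - γ • (h' x + η • f' x))‖ ^ 2
      = 1 / (2 * γ) * ‖v - x‖ ^ 2 + (⟪h' x, v - x⟫ + η * ⟪f' x, v - x⟫)
        + 1 / (2 * γ) * ‖γ • (h' x + η • f' x)‖ ^ 2 := by
    intro v
    rw [show v - (x - γ • (h' x + η • f' x)) = (v - x) + γ • (h' x + η • f' x) by abel,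
      norm_add_sq_real, inner_smul_right, inner_add_right, inner_smul_right,
      real_inner_comm, real_inner_comm (f' x)]
    field_simp
  rw [hexp, hexp] at hprox
  have hh_desc := le_add_inner_add_of_lipschitz_gradient hh_grad hh_lip x p
  have hf_desc := mul_le_mul_of_nonneg_left
    (le_add_inner_add_of_lipschitz_gradient hf_grad hf_lip x p) hη
  have hh_low := (strongConvexOn_zero.2 hh_conv).add_inner_add_le hh_grad x u
  have hf_low := mul_le_mul_of_nonneg_left (hf_sc.add_inner_add_le hf_grad x u) hη
  have hquad := mul_le_mul_of_nonneg_right hγη (sq_nonneg ‖p - x‖)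
  have hγ1 : 1 / (2 * γ) * ‖p - x‖ ^ 2 = 1 / γ * ‖p - x‖ ^ 2 / 2 := by field_simp
  have hγ2 : 1 / (2 * γ) * ((1 - η * γ * μf) * ‖u - x‖ ^ 2)
      = 1 / (2 * γ) * ‖u - x‖ ^ 2 - η * (μf / 2 * ‖u - x‖ ^ 2) := by
    field_simp
  rw [hγ2]
  linarith

theorem stmt_13
    {n : ℕ}
    (f h ωf ωh : EuclideanSpace ℝ (Fin n) → ℝ)
    (f' h' : EuclideanSpace ℝ (Fin n) → EuclideanSpace ℝ (Fin n))
    (Lf Lh μf : ℝ)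
    (hμf_pos : 0 < μf) (hμf_le : μf ≤ Lf) (hLh_pos : 0 < Lh)
    (hf_grad : ∀ x, HasGradientAt f (f' x) x)
    (hf_lip : ∀ x y, ‖f' x - f' y‖ ≤ Lf * ‖x - y‖)
    (hf_sc : StrongConvexOn Set.univ μf f)
    (hh_grad : ∀ x, HasGradientAt h (h' x) x)
    (hh_lip : ∀ x y, ‖h' x - h' y‖ ≤ Lh * ‖x - y‖)
    (hh_conv : ConvexOn ℝ Set.univ h)
    (hωf_conv : ConvexOn ℝ Set.univ ωf)
    (hωh_conv : ConvexOn ℝ Set.univ ωh)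
    (fbar hbar : EuclideanSpace ℝ (Fin n) → ℝ)
    (hfbar : ∀ x, fbar x = f x + ωf x)
    (hhbar : ∀ x, hbar x = h x + ωh x)
    (X : Set (EuclideanSpace ℝ (Fin n)))
    (hX : X = {z | ∀ y, hbar z ≤ hbar y})
    (hXne : X.Nonempty)
    (hstar : ℝ)
    (hhstar : IsGLB (Set.range hbar) hstar)
    (xstar : EuclideanSpace ℝ (Fin n))
    (hxstar_mem : xstar ∈ X)
    (hxstar_min : ∀ y ∈ X, fbar xstar ≤ fbar y)
    (Cf : ℝ)
    (hCf : IsGLB (Set.range fbar) Cf)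
    (x : ℕ → EuclideanSpace ℝ (Fin n))
    (η : ℕ → ℝ) (γ : ℝ)
    (hγ_pos : 0 < γ)
    (hμ2 : μf < 2 * Lf)
    (hγ_le : γ ≤ 1 / (2 * Lh))
    (η0u η0l : ℝ)
    (hη0u : η0u = 1 / (γ * μf))
    (hη0l : η0l = 2 * Lf / μf)
    (hη : ∀ k : ℕ, η k = η0u / (η0l + (k : ℝ)))
    (hx_iter : ∀ k u,
      ωh (x (k+1)) + η k * ωf (x (k+1))
        + 1 / (2*γ) * ‖x (k+1) - (x k - γ • (h' (x k) + η k • f' (x k)))‖ ^ 2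
      ≤ ωh u + η k * ωf u
        + 1 / (2*γ) * ‖u - (x k - γ • (h' (x k) + η k • f' (x k)))‖ ^ 2)
    (θ : ℕ → ℝ)
    (hθ : ∀ k, θ k = 1 / ∏ t ∈ Finset.range (k+1), (1 - η t * γ * μf))
    (xbar : ℕ → EuclideanSpace ℝ (Fin n))
    (hxbar : ∀ K, xbar K = (∑ j ∈ Finset.range K, θ j * η j)⁻¹ •
        ∑ k ∈ Finset.range K, (θ k * η k) • x (k+1))
    :
    ∀ K : ℕ, 1 ≤ K →
      0 ≤ hbar (xbar K) - hstar
      ∧ hbar (xbar K) - hstar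
          ≤ γ * (2 * Lf - μf) * (η 0 * ‖x 0 - xstar‖ ^ 2 / (2 * γ)
              + (fbar xstar - Cf) * (η0u ^ 2 / (η0l - 1))
                * (η0l + Real.log (((K : ℝ) + η0l - 1) / η0l))) / K := by
  intro K hK
  have hLf_pos : 0 < Lf := hμf_pos.trans_le hμf_le
  have hl : 1 < η0l := by rw [hη0l, one_lt_div hμf_pos]; exact hμ2
  have hl_pos : 0 < η0l := one_pos.trans hl
  have hu_pos : 0 < η0u := by rw [hη0u]; positivity
  have hu_mul : η0u * (γ * μf) = 1 := by rw [hη0u]; field_simp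
  have hl_mul : η0l * μf = 2 * Lf := by rw [hη0l]; field_simp
  have hη_nonneg : ∀ k, 0 ≤ η k := fun k ↦ by rw [hη]; positivity
  have hη_mul : ∀ k : ℕ, η k * γ * μf = 1 / (η0l + k) := by
    intro k
    rw [hη, mul_assoc, div_mul_eq_mul_div, hu_mul]
  have hη_le : ∀ k, η k * Lf ≤ 1 / (2 * γ) := by
    intro k
    have hle : η k * γ * μf ≤ 1 / η0l := by
      rw [hη_mul]
      exact one_div_le_one_div_of_le hl_pos (by linarith [k.cast_nonneg (α := ℝ)])
    rw [le_div_iff₀ hl_pos] at hle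
    rw [le_div_iff₀ (by positivity)]
    linear_combination hle - η k * γ * hl_mul
  have hstepsize : ∀ k, Lh + η k * Lf ≤ 1 / γ := by
    intro k
    have hLh : Lh ≤ 1 / (2 * γ) := by
      rw [le_div_iff₀ (by positivity)] at hγ_le ⊢
      linarith
    have hhalf : 1 / γ = 1 / (2 * γ) + 1 / (2 * γ) := by
      field_simp
      norm_num
    linarith [hη_le k]
  have hhstar_le : ∀ y, hstar ≤ hbar y := fun y ↦ hhstar.1 ⟨y, rfl⟩
  have hCf_le : ∀ y, Cf ≤ fbar y := fun y ↦ hCf.1 ⟨y, rfl⟩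
  have hbar_xstar : hbar xstar ≤ hstar := by
    rw [hX] at hxstar_mem
    exact hhstar.2 (by rintro _ ⟨y, rfl⟩; exact hxstar_mem y)
  have hbar_conv : ConvexOn ℝ Set.univ hbar :=
    (hh_conv.add hωh_conv).congr fun y _ ↦ (hhbar y).symm
  have hstep : ∀ k : ℕ, hbar (x (k + 1)) - hstar ≤ (fbar xstar - Cf) * η0u * (1 / (η0l + k))
      + 1 / (2 * γ) * ((1 - 1 / (η0l + k)) * ‖x k - xstar‖ ^ 2 - ‖x (k + 1) - xstar‖ ^ 2) := by
    intro k
    have h1 := proximal_gradient_step_s13 hf_grad hf_lip hf_sc hh_grad hh_lip hh_conv hωf_conv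
      hωh_conv (hη_nonneg k) hγ_pos (hstepsize k) (hx_iter k) xstar
    rw [hη_mul, ← hhbar, ← hhbar, ← hfbar, ← hfbar, norm_sub_rev xstar, norm_sub_rev xstar] at h1
    have h2 := mul_le_mul_of_nonneg_left (hCf_le (x (k + 1))) (hη_nonneg k)
    have h3 : (fbar xstar - Cf) * η0u * (1 / (η0l + k)) = η k * fbar xstar - η k * Cf := by
      rw [hη]
      ring
    rw [h3]
    linarith
  have hsum : ∀ m : ℕ, ∑ k ∈ Finset.range (m + 1), (hbar (x (k + 1)) - hstar)
      ≤ (fbar xstar - Cf) * η0u * ∑ k ∈ Finset.range (m + 1), 1 / (η0l + k)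
        + 1 / (2 * γ) * ((1 - 1 / η0l) * ‖x 0 - xstar‖ ^ 2 - ‖x (m + 1) - xstar‖ ^ 2) := by
    intro m
    induction m with
    | zero => simpa using hstep 0
    | succ m ih =>
      rw [Finset.sum_range_succ, Finset.sum_range_succ _ (m + 1), mul_add]
      have hdrop : 0 ≤ 1 / (2 * γ) * (1 / (η0l + ((m + 1 : ℕ) : ℝ)) * ‖x (m + 1) - xstar‖ ^ 2) := by
        positivity
      linarith [hstep (m + 1)]
  have hweight : ∀ k, θ k * η k = η0u / (η0l - 1) := by
    intro k
    have hne : η0l + (k : ℝ) ≠ 0 := by positivity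
    have hne' : η0l - 1 ≠ 0 := (sub_pos.2 hl).ne'
    simp_rw [hθ, hη_mul]
    rw [one_div_prod_range_one_sub_one_div_add hl, hη]
    field_simp
  have hweight_pos : 0 < η0u / (η0l - 1) := div_pos hu_pos (sub_pos.2 hl)
  have hK_pos : (0 : ℝ) < K := by exact_mod_cast hK
  have hjensen : (hbar (xbar K) - hstar) * K
      ≤ ∑ k ∈ Finset.range K, (hbar (x (k + 1)) - hstar) := by
    have hJ := hbar_conv.map_centerMass_le (t := Finset.range K) (w := fun k ↦ θ k * η k)
      (p := fun k ↦ x (k + 1)) (fun k _ ↦ by rw [hweight]; exact hweight_pos.le)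
      (by
        simp only [hweight, Finset.sum_const, Finset.card_range, nsmul_eq_mul]
        positivity)
      (fun _ _ ↦ Set.mem_univ _)
    rw [Finset.centerMass, ← hxbar] at hJ
    simp only [Finset.centerMass, hweight, Finset.sum_const, Finset.card_range, nsmul_eq_mul,
      smul_eq_mul, Function.comp_apply, ← Finset.mul_sum] at hJ
    rw [mul_inv, mul_assoc, inv_mul_cancel_left₀ hweight_pos.ne', ← div_eq_inv_mul,
      le_div_iff₀ hK_pos] at hJ
    simp only [Finset.sum_sub_distrib, Finset.sum_const, Finset.card_range, nsmul_eq_mul]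
    linarith
  refine ⟨sub_nonneg.2 (hhstar_le _), ?_⟩
  rw [le_div_iff₀ hK_pos]
  refine hjensen.trans ?_
  obtain ⟨m, rfl⟩ := Nat.exists_eq_add_of_le' hK
  have hharm : ∑ k ∈ Finset.range (m + 1), 1 / (η0l + k)
      ≤ η0l + Real.log ((((m + 1 : ℕ) : ℝ) + η0l - 1) / η0l) := by
    have hinv : 1 / η0l ≤ 1 := (div_le_one hl_pos).2 hl.le
    have hcast : ((m + 1 : ℕ) : ℝ) + η0l - 1 = m + η0l := by push_cast; ring
    rw [hcast]
    linarith [sum_range_one_div_add_le hl_pos m]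
  have hgap := mul_le_mul_of_nonneg_left hharm
    (mul_nonneg (sub_nonneg.2 (hCf_le xstar)) hu_pos.le)
  have hdrop : 0 ≤ 1 / (2 * γ) * ‖x (m + 1) - xstar‖ ^ 2 := by positivity
  have hscale : γ * (2 * Lf - μf) * η0u = η0l - 1 := by
    linear_combination (η0l - 1) * hu_mul - γ * η0u * hl_mul
  have hcoef_gap : γ * (2 * Lf - μf) * (η0u ^ 2 / (η0l - 1)) = η0u := by
    rw [← mul_div_assoc, div_eq_iff (sub_pos.2 hl).ne']
    linear_combination η0u * hscale
  have hcoef_dist : γ * (2 * Lf - μf) * η 0 = 1 - 1 / η0l := by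
    rw [hη, Nat.cast_zero, add_zero, ← mul_div_assoc, hscale, sub_div, div_self hl_pos.ne']
  calc _ ≤ _ := hsum m
    _ ≤ 1 / (2 * γ) * ((1 - 1 / η0l) * ‖x 0 - xstar‖ ^ 2) + (fbar xstar - Cf) * η0u
        * (η0l + Real.log ((((m + 1 : ℕ) : ℝ) + η0l - 1) / η0l)) := by linarith
    _ = _ := by
      rw [← hcoef_dist]
      nth_rewrite 1 [← hcoef_gap]
      ring
end
end
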